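/- There exists ε₀ > 0 and c > 0 such that for every smooth algebraic function P : ℝ²×ℝ² → ℝ with ‖P‖_{C³} < ε₀, the function Φ(x,y) = |x−y| + P(x,y) satisfies the cinematic curvature conditions uniformly at every pair (a,b) with a, b ∈ [0,1]² and 1/2 ≤ |a−b|: namely |∇_yΦ(a,b)| ≥ c, and for e a unit vector orthogonal to ∇_yΦ(a,b), the absolute value of the determinant of the 2×2 matrix whose rows are ∇_x[e·∇_yΦ(x,y)] and ∇_x[e·∇_y(e·∇_yΦ(x,y)/|∇_yΦ(x,y)|)], evaluated at (x,y) = (a,b), is at least c. -/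

import Mathlib

open Metric Set MeasureTheory
open scoped RealInnerProductSpace ENNReal NNReal

noncomputable section

/-- The Euclidean plane. -/
abbrev E2 : Type := EuclideanSpace ℝ (Fin 2)

/-- Gradient of `Φ` in the second (`y`) variable. -/
noncomputable def gradY (Φ : E2 → E2 → ℝ) (x y : E2) : E2 :=
  gradient (fun y' => Φ x y') y

/-- Gradient of a scalar function of `(x,y)` in the first (`x`) variable. -/
noncomputable def gradX (f : E2 → E2 → ℝ) (x y : E2) : E2 :=
  gradient (fun x' => f x' y) x

/-- First row entry function `e · ∇_y Φ(x,y)` of the cinematic curvature matrix. -/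
noncomputable def cinRow1 (Φ : E2 → E2 → ℝ) (e : E2) (x y : E2) : ℝ :=
  ⟪e, gradY Φ x y⟫

/-- Second row entry function `e · ∇_y (e·∇_yΦ(x,y)/|∇_yΦ(x,y)|)`. -/
noncomputable def cinRow2 (Φ : E2 → E2 → ℝ) (e : E2) (x y : E2) : ℝ :=
  ⟪e, gradY (fun x' y' => ⟪e, gradY Φ x' y'⟫ / ‖gradY Φ x' y'‖) x y⟫

/-- Determinant of the 2×2 matrix with rows `∇_x[e·∇_yΦ]` and
`∇_x[e·∇_y(e·∇_yΦ/|∇_yΦ|)]`, evaluated at `(x,y)`. -/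
noncomputable def cinDet (Φ : E2 → E2 → ℝ) (e : E2) (x y : E2) : ℝ :=
  gradX (cinRow1 Φ e) x y 0 * gradX (cinRow2 Φ e) x y 1
    - gradX (cinRow1 Φ e) x y 1 * gradX (cinRow2 Φ e) x y 0

/-- The cinematic curvature conditions at the point `(a,b)`. -/
def CinematicAt (Φ : E2 → E2 → ℝ) (a b : E2) : Prop :=
  gradY Φ a b ≠ 0 ∧
    ∀ e : E2, ‖e‖ = 1 → ⟪e, gradY Φ a b⟫ = 0 → cinDet Φ e a b ≠ 0

/-- The cinematic curvature conditions, uniformly on `U₁ × U₂`: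
the gradient in `y` and the cinematic determinant are bounded away from `0`. -/
def CinematicOn (Φ : E2 → E2 → ℝ) (U₁ U₂ : Set E2) : Prop :=
  ∃ c > 0, ∀ x ∈ U₁, ∀ y ∈ U₂,
    c ≤ ‖gradY Φ x y‖ ∧
      ∀ e : E2, ‖e‖ = 1 → ⟪e, gradY Φ x y⟫ = 0 → c ≤ |cinDet Φ e x y|

/-- `Φ` is an algebraic function on `U₁ × U₂`: a nonzero real polynomial
in five variables annihilates its graph. -/
def IsAlgebraicOn (Φ : E2 → E2 → ℝ) (U₁ U₂ : Set E2) : Prop :=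
  ∃ P : MvPolynomial (Fin 5) ℝ, P ≠ 0 ∧
    ∀ x ∈ U₁, ∀ y ∈ U₂,
      MvPolynomial.eval (![x 0, x 1, y 0, y 1, Φ x y]) P = 0

/-- Parameters (center, radius) of a Φ-circle. -/
abbrev CParam : Type := E2 × ℝ

/-- `c` is an admissible Φ-circle parameter: center in `U₁` and radius in `(1-τ,1)`. -/
def IsCircleParam (U₁ : Set E2) (τ : ℝ) (c : CParam) : Prop :=
  c.1 ∈ U₁ ∧ c.2 ∈ Set.Ioo (1 - τ) 1

/-- The Φ-circle `Γ(x₀,r₀) = {y ∈ B(b,α) : Φ(x₀,y) = r₀}`. -/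
def circleSet (Φ : E2 → E2 → ℝ) (b : E2) (α : ℝ) (c : CParam) : Set E2 :=
  {y ∈ ball b α | Φ c.1 y = c.2}

/-- The δ-neighborhood `Γ^δ` of a Φ-circle. -/
def cthick (Φ : E2 → E2 → ℝ) (b : E2) (α δ : ℝ) (c : CParam) : Set E2 :=
  Metric.thickening δ (circleSet Φ b α c)

/-- The distance `d(Γ,Γ̃) = |x₀ - x̃₀| + |r₀ - r̃₀|` between Φ-circles. -/
def pdist (c c' : CParam) : ℝ := dist c.1 c'.1 + |c.2 - c'.2|

/-- The unit normal `∇_yΦ(x,y)/|∇_yΦ(x,y)|`. -/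
noncomputable def normGradY (Φ : E2 → E2 → ℝ) (x y : E2) : E2 :=
  ‖gradY Φ x y‖⁻¹ • gradY Φ x y

/-- The tangency distance `Δ_X(Γ,Γ̃)`. -/
noncomputable def DeltaDist (Φ : E2 → E2 → ℝ) (X : Set E2) (c c' : CParam) : ℝ :=
  sInf {d : ℝ | ∃ y ∈ closure X, ∃ y' ∈ closure X,
    Φ c.1 y = c.2 ∧ Φ c'.1 y' = c'.2 ∧
      d = dist y y' + ‖normGradY Φ c.1 y - normGradY Φ c'.1 y'‖}

/-- `R` is a `(δ,t)`-rectangle: the δ-neighborhood of a connected arc of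
1-dimensional Hausdorff measure (arclength) `√(δ/t)` of some Φ-circle. -/
def IsRect (Φ : E2 → E2 → ℝ) (b : E2) (α : ℝ) (U₁ : Set E2) (τ δ t : ℝ)
    (R : Set E2) : Prop :=
  ∃ c : CParam, IsCircleParam U₁ τ c ∧
    ∃ A : Set E2, A ⊆ circleSet Φ b α c ∧ IsConnected A ∧
      μH[1] A = ENNReal.ofReal (Real.sqrt (δ / t)) ∧
      R = Metric.thickening δ A

/-- The Φ-circle `c` is incident to the rectangle `R`: `R` is contained in the
`C₁δ`-neighborhood of the circle. -/
def Incident (Φ : E2 → E2 → ℝ) (b : E2) (α δ C₁ : ℝ) (c : CParam) (R : Set E2) : Prop :=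
  R ⊆ Metric.thickening (C₁ * δ) (circleSet Φ b α c)

/-- Two `(δ,t)`-rectangles are close: some `(2δ,t)`-rectangle contains both. -/
def CloseRect (Φ : E2 → E2 → ℝ) (b : E2) (α : ℝ) (U₁ : Set E2) (τ δ t : ℝ)
    (R R' : Set E2) : Prop :=
  ∃ R₀, IsRect Φ b α U₁ τ (2 * δ) t R₀ ∧ R ⊆ R₀ ∧ R' ⊆ R₀

/-- Two `(δ,t)`-rectangles are comparable: some `(C₀δ,t)`-rectangle contains both. -/
def ComparableRect (Φ : E2 → E2 → ℝ) (b : E2) (α : ℝ) (U₁ : Set E2) (τ C₀ δ t : ℝ)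
    (R R' : Set E2) : Prop :=
  ∃ R₀, IsRect Φ b α U₁ τ (C₀ * δ) t R₀ ∧ R ⊆ R₀ ∧ R' ⊆ R₀

/-- `(W,B)` is a `t`-bipartite pair of families of Φ-circles. -/
def Bipartite (U₁ : Set E2) (τ δ t : ℝ) (W B : Finset CParam) : Prop :=
  (∀ c : CParam, c ∈ W ∨ c ∈ B → IsCircleParam U₁ τ c) ∧
  (∀ c c' : CParam, (c ∈ W ∨ c ∈ B) → (c' ∈ W ∨ c' ∈ B) → c ≠ c' →
    δ ≤ |c.2 - c'.2|) ∧
  (∀ c ∈ W, ∀ c' ∈ B, pdist c c' ∈ Set.Ioo t (2 * t)) ∧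
  (∀ c ∈ W, ∀ c' ∈ W, c ≠ c' → pdist c c' ∈ Set.Ioo 0 t) ∧
  (∀ c ∈ B, ∀ c' ∈ B, c ≠ c' → pdist c c' ∈ Set.Ioo 0 t)

/-- The number of circles of the family `W` incident to `R`. -/
noncomputable def incCount (Φ : E2 → E2 → ℝ) (b : E2) (α δ C₁ : ℝ)
    (W : Finset CParam) (R : Set E2) : ℕ :=
  Set.ncard {c : CParam | c ∈ W ∧ Incident Φ b α δ C₁ c R}

/-- `R` is of type `(≳μ,≳ν)` relative to `(W,B)`: incident to at least `Cabs·μ`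
circles of `W` and at least `Cabs·ν` circles of `B`. -/
def RectTypeGE (Φ : E2 → E2 → ℝ) (b : E2) (α δ C₁ Cabs : ℝ)
    (W B : Finset CParam) (μ ν : ℝ) (R : Set E2) : Prop :=
  Cabs * μ ≤ (incCount Φ b α δ C₁ W R : ℝ) ∧
  Cabs * ν ≤ (incCount Φ b α δ C₁ B R : ℝ)

/-- The set of δ-tangent pairs `I_X(W,B)`. -/
def Iset (Φ : E2 → E2 → ℝ) (X : Set E2) (δ : ℝ)
    (W B : Finset CParam) : Set (CParam × CParam) :=
  {p : CParam × CParam | p.1 ∈ W ∧ p.2 ∈ B ∧ DeltaDist Φ X p.1 p.2 < δ}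

/-- The derivative of `F` in the direction `w`. -/
def dirDeriv {E : Type*} [NormedAddCommGroup E] [NormedSpace ℝ E] (w : E) (F : E → ℝ) (p : E) : ℝ :=
  fderiv ℝ F p w

section DirDeriv

variable {E : Type*} [NormedAddCommGroup E] [NormedSpace ℝ E]

open scoped Topology ContDiff

theorem hasDerivAt_line {F : E → ℝ} {p : E} (h : DifferentiableAt ℝ F p) (w : E) :
    HasDerivAt (fun t : ℝ => F (p + t • w)) (dirDeriv w F p) 0 :=
  h.hasFDerivAt.hasLineDerivAt w

theorem dirDeriv_eq_of_hasDerivAt {F : E → ℝ} {p w : E} {d : ℝ} (h : DifferentiableAt ℝ F p)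
    (hd : HasDerivAt (fun t : ℝ => F (p + t • w)) d 0) : dirDeriv w F p = d :=
  (hasDerivAt_line h w).unique hd

theorem differentiableAt_div {F H : E → ℝ} {p : E} (hF : DifferentiableAt ℝ F p)
    (hH : DifferentiableAt ℝ H p) (h0 : H p ≠ 0) : DifferentiableAt ℝ (fun q => F q / H q) p := by
  simpa only [div_eq_mul_inv] using hF.fun_mul (hH.fun_inv h0)

theorem Filter.EventuallyEq.dirDeriv {F H : E → ℝ} {p : E} (h : F =ᶠ[𝓝 p] H) (w : E) :
    dirDeriv w F =ᶠ[𝓝 p] dirDeriv w H := by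
  filter_upwards [h.fderiv (𝕜 := ℝ)] with q hq
  simp only [_root_.dirDeriv, hq]

theorem ContDiffAt.dirDeriv {F : E → ℝ} {p : E} (h : ContDiffAt ℝ ∞ F p) (w : E) :
    ContDiffAt ℝ ∞ (dirDeriv w F) p :=
  (h.fderiv_right (m := ∞) (by simp)).clm_apply contDiffAt_const

theorem dirDeriv_add {F H : E → ℝ} {p : E} (hF : DifferentiableAt ℝ F p)
    (hH : DifferentiableAt ℝ H p) (w : E) :
    dirDeriv w (fun q => F q + H q) p = dirDeriv w F p + dirDeriv w H p := by
  simp [dirDeriv, fderiv_fun_add hF hH]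

theorem norm_iteratedFDeriv_dirDeriv_le {F : E → ℝ} (hF : ContDiff ℝ ∞ F) {w : E}
    (hw : ‖w‖ ≤ 1) (n : ℕ) (p : E) :
    ‖iteratedFDeriv ℝ n (dirDeriv w F) p‖ ≤ ‖iteratedFDeriv ℝ (n + 1) F p‖ := by
  have h := norm_iteratedFDeriv_clm_apply_const (c := w) (n := n) (N := ∞)
    ((hF.fderiv_right (m := ∞) (by simp)).contDiffAt (x := p)) (by exact_mod_cast le_top)
  rw [norm_iteratedFDeriv_fderiv] at h
  exact h.trans (mul_le_of_le_one_left (norm_nonneg _) hw)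

theorem ContDiff.dirDeriv {F : E → ℝ} (hF : ContDiff ℝ ∞ F) (w : E) :
    ContDiff ℝ ∞ (dirDeriv w F) :=
  contDiff_iff_contDiffAt.2 fun _ => hF.contDiffAt.dirDeriv w

theorem abs_dirDeriv_le {F : E → ℝ} (hF : ContDiff ℝ ∞ F) {w : E} (hw : ‖w‖ ≤ 1) (p : E) :
    |dirDeriv w F p| ≤ ‖iteratedFDeriv ℝ 1 F p‖ := by
  simpa using norm_iteratedFDeriv_dirDeriv_le hF hw 0 p

theorem abs_dirDeriv_dirDeriv_le {F : E → ℝ} (hF : ContDiff ℝ ∞ F) {v w : E}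
    (hv : ‖v‖ ≤ 1) (hw : ‖w‖ ≤ 1) (p : E) :
    |dirDeriv v (dirDeriv w F) p| ≤ ‖iteratedFDeriv ℝ 2 F p‖ :=
  (abs_dirDeriv_le (hF.dirDeriv w) hv p).trans (norm_iteratedFDeriv_dirDeriv_le hF hw 1 p)

theorem abs_dirDeriv_dirDeriv_dirDeriv_le {F : E → ℝ} (hF : ContDiff ℝ ∞ F) {u v w : E}
    (hu : ‖u‖ ≤ 1) (hv : ‖v‖ ≤ 1) (hw : ‖w‖ ≤ 1) (p : E) :
    |dirDeriv u (dirDeriv v (dirDeriv w F)) p| ≤ ‖iteratedFDeriv ℝ 3 F p‖ :=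
  (abs_dirDeriv_dirDeriv_le (hF.dirDeriv w) hu hv p).trans
    (norm_iteratedFDeriv_dirDeriv_le hF hw 2 p)

/-- Derivative of the normalized component `f / √(f² + g²)`. -/
theorem dirDeriv_div_sqrt {f g : E → ℝ} {p : E} (hf : DifferentiableAt ℝ f p)
    (hg : DifferentiableAt ℝ g p) (h0 : f p ^ 2 + g p ^ 2 ≠ 0) (w : E) :
    dirDeriv w (fun q => f q / √(f q ^ 2 + g q ^ 2)) p =
      g p * (g p * dirDeriv w f p - f p * dirDeriv w g p) / √(f p ^ 2 + g p ^ 2) ^ 3 := by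
  have hs : √(f p ^ 2 + g p ^ 2) ≠ 0 := by
    rw [Real.sqrt_ne_zero']; exact lt_of_le_of_ne (by positivity) h0.symm
  have h2 : √(f p ^ 2 + g p ^ 2) ^ 2 = f p ^ 2 + g p ^ 2 := Real.sq_sqrt (by positivity)
  apply dirDeriv_eq_of_hasDerivAt
  · exact differentiableAt_div hf (((hf.fun_pow 2).fun_add (hg.fun_pow 2)).sqrt h0) hs
  · have hf' := hasDerivAt_line hf w
    have hg' := hasDerivAt_line hg w
    have := hf'.fun_div (((hf'.fun_pow 2).fun_add (hg'.fun_pow 2)).sqrt (by simpa using h0)) (by simpa using hs)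
    refine this.congr_deriv ?_
    simp only [zero_smul, add_zero]
    generalize √(f p ^ 2 + g p ^ 2) = s at *
    field_simp
    simp only [h2]
    push_cast
    ring

theorem dirDeriv_normalized_deriv {f g k l : E → ℝ} {p : E} (hf : DifferentiableAt ℝ f p)
    (hg : DifferentiableAt ℝ g p) (hk : DifferentiableAt ℝ k p) (hl : DifferentiableAt ℝ l p)
    (h0 : f p = 0) (hg0 : g p ≠ 0) (w : E) :
    dirDeriv w (fun q => g q * (g q * k q - f q * l q) / √(f q ^ 2 + g q ^ 2) ^ 3) p =
      (dirDeriv w k p - k p * dirDeriv w g p / g p - l p * dirDeriv w f p / g p) / |g p| := by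
  have hn : f p ^ 2 + g p ^ 2 ≠ 0 := by simpa [h0] using hg0
  have hs : √(f p ^ 2 + g p ^ 2) ≠ 0 := by simpa [h0, Real.sqrt_sq_eq_abs] using hg0
  apply dirDeriv_eq_of_hasDerivAt
  · exact differentiableAt_div (hg.fun_mul ((hg.fun_mul hk).fun_sub (hf.fun_mul hl)))
      ((((hf.fun_pow 2).fun_add (hg.fun_pow 2)).sqrt hn).fun_pow 3) (pow_ne_zero _ hs)
  · have hf' := hasDerivAt_line hf w
    have hg' := hasDerivAt_line hg w
    have hk' := hasDerivAt_line hk w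
    have hl' := hasDerivAt_line hl w
    have := (hg'.fun_mul ((hg'.fun_mul hk').fun_sub (hf'.fun_mul hl'))).fun_div
      ((((hf'.fun_pow 2).fun_add (hg'.fun_pow 2)).sqrt (by simpa using hn)).fun_pow 3)
      (by simpa using hs)
    refine this.congr_deriv ?_
    simp only [zero_smul, add_zero, h0]
    have e : √((0:ℝ) ^ 2 + g p ^ 2) = |g p| := by simp [Real.sqrt_sq_eq_abs]
    rw [e]
    rcases hg0.lt_or_gt with h | h
    · rw [abs_of_neg h]
      field_simp
      push_cast
      ring
    · rw [abs_of_pos h]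
      field_simp
      push_cast
      ring

end DirDeriv

section Distance

open scoped Topology ContDiff

variable {V : Type*} [NormedAddCommGroup V] [InnerProductSpace ℝ V]

theorem contDiffAt_norm_sub {p : V × V} (hp : p.1 ≠ p.2) :
    ContDiffAt ℝ ∞ (fun q : V × V => ‖q.2 - q.1‖) p :=
  (contDiffAt_snd.sub contDiffAt_fst).norm ℝ (sub_ne_zero.2 hp.symm)

theorem differentiableAt_inner_sub (v : V) (p : V × V) :
    DifferentiableAt ℝ (fun q : V × V => ⟪q.2 - q.1, v⟫) p :=
  (differentiableAt_snd.sub differentiableAt_fst).inner ℝ (differentiableAt_const v)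

theorem dirDeriv_inner_sub (v : V) (w p : V × V) :
    dirDeriv w (fun q : V × V => ⟪q.2 - q.1, v⟫) p = ⟪w.2 - w.1, v⟫ := by
  have h : HasFDerivAt (fun q : V × V => ⟪q.2 - q.1, v⟫)
      ((innerSL ℝ v).comp (ContinuousLinearMap.snd ℝ V V - ContinuousLinearMap.fst ℝ V V)) p := by
    convert ((innerSL ℝ v).comp
      (ContinuousLinearMap.snd ℝ V V - ContinuousLinearMap.fst ℝ V V)).hasFDerivAt using 2 with q
    simp [real_inner_comm, inner_sub_right]
  simp only [dirDeriv, h.fderiv]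
  simp [real_inner_comm, inner_sub_right]

theorem dirDeriv_norm_sub {p : V × V} (hp : p.1 ≠ p.2) (w : V × V) :
    dirDeriv w (fun q : V × V => ‖q.2 - q.1‖) p = ⟪p.2 - p.1, w.2 - w.1⟫ / ‖p.2 - p.1‖ := by
  have h0 : ‖p.2 - p.1‖ ≠ 0 := norm_ne_zero_iff.2 (sub_ne_zero.2 hp.symm)
  have h1 := (hasDerivAt_line ((contDiffAt_norm_sub hp).differentiableAt (by simp)) w).fun_pow 2
  have h2 : HasDerivAt (fun t : ℝ => (p.2 - p.1) + t • (w.2 - w.1)) (w.2 - w.1) 0 := by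
    simpa using ((hasDerivAt_id (0:ℝ)).smul_const (w.2 - w.1)).const_add (p.2 - p.1)
  have h3 := h2.norm_sq
  have h4 : (fun t : ℝ => ‖(p.2 - p.1) + t • (w.2 - w.1)‖ ^ 2) =
      (fun t : ℝ => ‖(p + t • w).2 - (p + t • w).1‖) ^ 2 := by
    ext t
    simp only [Pi.pow_apply, Prod.snd_add, Prod.fst_add, Prod.smul_fst, Prod.smul_snd, smul_sub]
    congr 2; abel
  rw [h4] at h3
  have h5 := h1.unique h3
  simp at h5
  rw [eq_div_iff h0]
  linarith

theorem dirDeriv_dirDeriv_norm_sub {p : V × V} (hp : p.1 ≠ p.2) (v w : V × V) :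
    dirDeriv w (dirDeriv v (fun q : V × V => ‖q.2 - q.1‖)) p =
      ⟪w.2 - w.1, v.2 - v.1⟫ / ‖p.2 - p.1‖ -
        ⟪p.2 - p.1, v.2 - v.1⟫ * ⟪p.2 - p.1, w.2 - w.1⟫ / ‖p.2 - p.1‖ ^ 3 := by
  have h0 : ‖p.2 - p.1‖ ≠ 0 := norm_ne_zero_iff.2 (sub_ne_zero.2 hp.symm)
  have hr := (contDiffAt_norm_sub hp).differentiableAt (by simp)
  have ho : ∀ᶠ q : V × V in 𝓝 p, q.1 ≠ q.2 :=
    (isOpen_ne_fun continuous_fst continuous_snd).mem_nhds hp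
  have he : dirDeriv v (fun q : V × V => ‖q.2 - q.1‖) =ᶠ[𝓝 p]
      fun q => ⟪q.2 - q.1, v.2 - v.1⟫ / ‖q.2 - q.1‖ := by
    filter_upwards [ho] with q hq using dirDeriv_norm_sub hq v
  rw [(he.dirDeriv w).eq_of_nhds]
  have hi := differentiableAt_inner_sub (v.2 - v.1) p
  apply dirDeriv_eq_of_hasDerivAt (differentiableAt_div hi hr h0)
  refine ((hasDerivAt_line hi w).fun_div (hasDerivAt_line hr w) (by simpa using h0)).congr_deriv ?_
  rw [dirDeriv_inner_sub, dirDeriv_norm_sub hp]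
  simp only [zero_smul, add_zero]
  field_simp

theorem dirDeriv_dirDeriv_dirDeriv_norm_sub {p : V × V} (hp : p.1 ≠ p.2) (u v w : V × V) :
    dirDeriv w (dirDeriv v (dirDeriv u (fun q : V × V => ‖q.2 - q.1‖))) p =
      -(⟪v.2 - v.1, u.2 - u.1⟫ * ⟪p.2 - p.1, w.2 - w.1⟫ +
        ⟪w.2 - w.1, u.2 - u.1⟫ * ⟪p.2 - p.1, v.2 - v.1⟫ +
        ⟪w.2 - w.1, v.2 - v.1⟫ * ⟪p.2 - p.1, u.2 - u.1⟫) / ‖p.2 - p.1‖ ^ 3 +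
      3 * ⟪p.2 - p.1, u.2 - u.1⟫ * ⟪p.2 - p.1, v.2 - v.1⟫ * ⟪p.2 - p.1, w.2 - w.1⟫ /
        ‖p.2 - p.1‖ ^ 5 := by
  have h0 : ‖p.2 - p.1‖ ≠ 0 := norm_ne_zero_iff.2 (sub_ne_zero.2 hp.symm)
  have hr := (contDiffAt_norm_sub hp).differentiableAt (by simp)
  have ho : ∀ᶠ q : V × V in 𝓝 p, q.1 ≠ q.2 :=
    (isOpen_ne_fun continuous_fst continuous_snd).mem_nhds hp
  have he : dirDeriv v (dirDeriv u (fun q : V × V => ‖q.2 - q.1‖)) =ᶠ[𝓝 p]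
      fun q => ⟪v.2 - v.1, u.2 - u.1⟫ / ‖q.2 - q.1‖ -
        ⟪q.2 - q.1, u.2 - u.1⟫ * ⟪q.2 - q.1, v.2 - v.1⟫ / ‖q.2 - q.1‖ ^ 3 := by
    filter_upwards [ho] with q hq using dirDeriv_dirDeriv_norm_sub hq u v
  rw [(he.dirDeriv w).eq_of_nhds]
  have hu := differentiableAt_inner_sub (u.2 - u.1) p
  have hv := differentiableAt_inner_sub (v.2 - v.1) p
  have hc := differentiableAt_const (𝕜 := ℝ) (x := p) ⟪v.2 - v.1, u.2 - u.1⟫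
  apply dirDeriv_eq_of_hasDerivAt ((differentiableAt_div hc hr h0).fun_sub
    (differentiableAt_div (hu.fun_mul hv) (hr.fun_pow 3) (pow_ne_zero 3 h0)))
  refine (((hasDerivAt_const (0:ℝ) ⟪v.2 - v.1, u.2 - u.1⟫).fun_div (hasDerivAt_line hr w)
    (by simpa using h0)).fun_sub (((hasDerivAt_line hu w).fun_mul (hasDerivAt_line hv w)).fun_div
      ((hasDerivAt_line hr w).fun_pow 3) (by simpa using h0))).congr_deriv ?_
  simp only [dirDeriv_inner_sub, dirDeriv_norm_sub hp]
  simp only [zero_smul, add_zero]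
  field_simp
  push_cast
  ring

end Distance

section Gradients

open scoped Topology ContDiff

theorem inner_gradX_of_eventuallyEq {f : E2 → E2 → ℝ} {H : E2 × E2 → ℝ} {a b : E2}
    (h : (fun p : E2 × E2 => f p.1 p.2) =ᶠ[𝓝 (a, b)] H) (hH : DifferentiableAt ℝ H (a, b))
    (v : E2) : ⟪v, gradX f a b⟫ = dirDeriv (v, 0) H (a, b) := by
  have h1 : HasFDerivAt (fun p : E2 × E2 => f p.1 p.2) (fderiv ℝ H (a, b)) (a, b) :=
    hH.hasFDerivAt.congr_of_eventuallyEq h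
  have h2 := h1.comp a (hasFDerivAt_prodMk_left (𝕜 := ℝ) a b)
  have h3 : fderiv ℝ (fun x => f x b) a = _ := h2.fderiv
  rw [gradX, inner_gradient_right, h3]
  simp [dirDeriv]

theorem inner_gradY_of_eventuallyEq {f : E2 → E2 → ℝ} {H : E2 × E2 → ℝ} {a b : E2}
    (h : (fun p : E2 × E2 => f p.1 p.2) =ᶠ[𝓝 (a, b)] H) (hH : DifferentiableAt ℝ H (a, b))
    (v : E2) : ⟪v, gradY f a b⟫ = dirDeriv (0, v) H (a, b) := by
  have h1 : HasFDerivAt (fun p : E2 × E2 => f p.1 p.2) (fderiv ℝ H (a, b)) (a, b) :=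
    hH.hasFDerivAt.congr_of_eventuallyEq h
  have h2 := h1.comp b (hasFDerivAt_prodMk_right (𝕜 := ℝ) a b)
  have h3 : fderiv ℝ (fun y => f a y) b = _ := h2.fderiv
  rw [gradY, inner_gradient_right, h3]
  simp [dirDeriv]

/-- The rotation of a plane vector by a right angle. -/
def rotate (e : E2) : E2 := !₂[-e 1, e 0]

theorem inner_eq_coord (v w : E2) : ⟪v, w⟫ = v 0 * w 0 + v 1 * w 1 := by
  simp [PiLp.inner_apply, Fin.sum_univ_two, mul_comm]

theorem coord_sq_add_sq {e : E2} (he : ‖e‖ = 1) : e 0 ^ 2 + e 1 ^ 2 = 1 := by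
  have := real_inner_self_eq_norm_sq e
  rw [inner_eq_coord, he] at this
  linarith

theorem norm_rotate (e : E2) : ‖rotate e‖ = ‖e‖ := by
  simp [EuclideanSpace.norm_eq, Fin.sum_univ_two, rotate, add_comm]

theorem inner_rotate_self (e : E2) : ⟪e, rotate e⟫ = 0 := by
  rw [inner_eq_coord]; simp [rotate]; ring

theorem norm_sq_eq_inner_sq_add {e : E2} (he : ‖e‖ = 1) (v : E2) :
    ‖v‖ ^ 2 = ⟪e, v⟫ ^ 2 + ⟪rotate e, v⟫ ^ 2 := by
  have := coord_sq_add_sq he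
  rw [← real_inner_self_eq_norm_sq, inner_eq_coord, inner_eq_coord, inner_eq_coord]
  simp only [rotate, PiLp.toLp_apply, Matrix.cons_val_zero, Matrix.cons_val_one]
  linear_combination (-(v 0 ^ 2 + v 1 ^ 2)) * this

theorem det_eq_inner_det {e : E2} (he : ‖e‖ = 1) (v w : E2) :
    v 0 * w 1 - v 1 * w 0 =
      ⟪e, v⟫ * ⟪rotate e, w⟫ - ⟪rotate e, v⟫ * ⟪e, w⟫ := by
  have := coord_sq_add_sq he
  simp only [inner_eq_coord]
  simp only [rotate, PiLp.toLp_apply, Matrix.cons_val_zero, Matrix.cons_val_one]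
  linear_combination (-(v 0 * w 1 - v 1 * w 0)) * this

/-- The cinematic determinant in terms of directional derivatives along the orthonormal frame
`(e, rotate e)`. -/
theorem cinDet_eq {Φ : E2 → E2 → ℝ} {F : E2 × E2 → ℝ} (hΦ : ∀ p : E2 × E2, Φ p.1 p.2 = F p)
    {a b e : E2} (hF : ContDiffAt ℝ ∞ F (a, b))
    (hsm : ∀ᶠ p in 𝓝 (a, b), ContDiffAt ℝ ∞ F p) (he : ‖e‖ = 1)
    (h0 : dirDeriv (0, e) F (a, b) = 0) (hg : dirDeriv (0, rotate e) F (a, b) ≠ 0) :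
    cinDet Φ e a b =
      (dirDeriv (e, 0) (dirDeriv (0, e) F) (a, b) *
          dirDeriv (rotate e, 0) (dirDeriv (0, e) (dirDeriv (0, e) F)) (a, b) -
        dirDeriv (rotate e, 0) (dirDeriv (0, e) F) (a, b) *
          dirDeriv (e, 0) (dirDeriv (0, e) (dirDeriv (0, e) F)) (a, b) -
        dirDeriv (0, e) (dirDeriv (0, e) F) (a, b) / dirDeriv (0, rotate e) F (a, b) *
          (dirDeriv (e, 0) (dirDeriv (0, e) F) (a, b) *
              dirDeriv (rotate e, 0) (dirDeriv (0, rotate e) F) (a, b) -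
            dirDeriv (rotate e, 0) (dirDeriv (0, e) F) (a, b) *
              dirDeriv (e, 0) (dirDeriv (0, rotate e) F) (a, b))) /
        |dirDeriv (0, rotate e) F (a, b)| := by
  set f := dirDeriv (0, e) F with hf
  set g := dirDeriv (0, rotate e) F with hgd
  have hΦF : (fun p : E2 × E2 => Φ p.1 p.2) = F := funext hΦ
  have hd : ∀ {H : E2 × E2 → ℝ} {p}, ContDiffAt ℝ ∞ H p → DifferentiableAt ℝ H p :=
    fun h => h.differentiableAt (by simp)
  have hgrad : ∀ᶠ p in 𝓝 (a, b), ∀ v : E2, ⟪v, gradY Φ p.1 p.2⟫ = dirDeriv (0, v) F p := by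
    filter_upwards [hsm] with p hp v
    exact inner_gradY_of_eventuallyEq (by rw [hΦF]) (hd hp) v
  have hrow1 : (fun p : E2 × E2 => cinRow1 Φ e p.1 p.2) =ᶠ[𝓝 (a, b)] f := by
    filter_upwards [hgrad] with p hp using hp e
  have hnorm : (fun p : E2 × E2 => ⟪e, gradY Φ p.1 p.2⟫ / ‖gradY Φ p.1 p.2‖) =ᶠ[𝓝 (a, b)]
      fun p => f p / √(f p ^ 2 + g p ^ 2) := by
    filter_upwards [hgrad] with p hp
    rw [← Real.sqrt_sq (norm_nonneg (gradY Φ p.1 p.2)), norm_sq_eq_inner_sq_add he, hp, hp]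
  have hfC : ContDiffAt ℝ ∞ f (a, b) := hF.dirDeriv (0, e)
  have hgC : ContDiffAt ℝ ∞ g (a, b) := hF.dirDeriv (0, rotate e)
  have hg0 : ∀ᶠ p in 𝓝 (a, b), g p ≠ 0 := hgC.continuousAt.eventually_ne hg
  have hrow2 : (fun p : E2 × E2 => cinRow2 Φ e p.1 p.2) =ᶠ[𝓝 (a, b)]
      fun p => g p * (g p * dirDeriv (0, e) f p - f p * dirDeriv (0, e) g p) /
        √(f p ^ 2 + g p ^ 2) ^ 3 := by
    filter_upwards [hnorm.eventuallyEq_nhds, hsm, hg0] with p hp hs hgp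
    have hn : f p ^ 2 + g p ^ 2 ≠ 0 := by positivity
    have hfp := hd (hs.dirDeriv (0, e))
    have hgp' := hd (hs.dirDeriv (0, rotate e))
    rw [← dirDeriv_div_sqrt hfp hgp' hn]
    refine inner_gradY_of_eventuallyEq
      (f := fun x' y' => ⟪e, gradY Φ x' y'⟫ / ‖gradY Φ x' y'‖) hp ?_ e
    exact differentiableAt_div hfp (((hfp.fun_pow 2).fun_add (hgp'.fun_pow 2)).sqrt hn) (by positivity)
  have hfD := hd hfC
  have hgD := hd hgC
  have hkD := hd (hfC.dirDeriv (0, e))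
  have hlD := hd (hgC.dirDeriv (0, e))
  have hn : f (a, b) ^ 2 + g (a, b) ^ 2 ≠ 0 := by positivity
  have hrow2D : DifferentiableAt ℝ
      (fun p => g p * (g p * dirDeriv (0, e) f p - f p * dirDeriv (0, e) g p) /
        √(f p ^ 2 + g p ^ 2) ^ 3) (a, b) :=
    differentiableAt_div (hgD.fun_mul ((hgD.fun_mul hkD).fun_sub (hfD.fun_mul hlD)))
      ((((hfD.fun_pow 2).fun_add (hgD.fun_pow 2)).sqrt hn).fun_pow 3) (by positivity)
  rw [cinDet, det_eq_inner_det he]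
  simp only [inner_gradX_of_eventuallyEq hrow1 hfD, inner_gradX_of_eventuallyEq hrow2 hrow2D]
  simp only [dirDeriv_normalized_deriv hfD hgD hkD hlD h0 hg]
  field_simp
  ring

end Gradients

/-- Quantitative lower bound for the determinant expression of a small perturbation. -/
theorem le_abs_perturbed_det {ρ t σ p1 p2 p3 p4 p5 p6 p7 p8 p9 : ℝ} (h1 : 2/3 ≤ ρ) (h2 : ρ ≤ 2)
    (hts : t^2+σ^2=1) (e1 : |p1| ≤ 1/1000) (e2 : |p2| ≤ 1/1000)
    (e3 : |p3| ≤ 1/1000) (e4 : |p4| ≤ 1/1000)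
    (e5 : |p5| ≤ 1/1000) (e6 : |p6| ≤ 1/1000)
    (e7 : |p7| ≤ 1/1000) (e8 : |p8| ≤ 1/1000) (e9 : |p9| ≤ 1/1000)
    (h0 : t + p1 = 0) {g αe αn βe βn γ νe νn : ℝ}
    (hg : g = σ + p2)
    (hαe : αe = -(1-t^2)*ρ + p3) (hαn : αn = t*σ*ρ + p4)
    (hβe : βe = (3*t-3*t^3)*ρ^2 + p5) (hβn : βn = (σ-3*t^2*σ)*ρ^2 + p6)
    (hγ : γ = (1-t^2)*ρ+p7) (hνe : νe = t*σ*ρ+p8) (hνn : νn = -(1-σ^2)*ρ+p9) :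
    g ≠ 0 ∧ 1/10 ≤ |(αe*βn-αn*βe-γ/g*(αe*νn-αn*νe))/(|g|)| := by
  have ht : |t| ≤ 1/1000 := by
    rw [show t = -p1 by linarith, abs_neg]; exact e1
  have ht2 : t^2 ≤ 1/1000000 := by
    have := pow_le_pow_left₀ (abs_nonneg t) ht 2
    rw [sq_abs] at this; linarith
  have ht0 := sq_nonneg t
  have hσ1 : |σ| ≤ 1 := by rw [abs_le_one_iff_mul_self_le_one]; nlinarith
  have hσ0 : 999/1000 ≤ |σ| := by
    apply abs_le_of_sq_le_sq' _ (abs_nonneg _) |>.2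
    rw [sq_abs]; linarith
  have hgu : |g| ≤ 1001/1000 := by
    rw [hg]; linarith [abs_add_le σ p2]
  have hgl : 998/1000 ≤ |g| := by
    have := abs_sub_abs_le_abs_sub σ (-p2)
    rw [abs_neg, sub_neg_eq_add] at this
    rw [hg]; linarith
  have hts' : |t*σ*ρ| ≤ 2/1000 := by
    rw [abs_mul, abs_mul, abs_of_nonneg (by linarith : 0 ≤ ρ)]
    calc _ ≤ (1/1000:ℝ)*1*2 := by gcongr
      _ = _ := by norm_num
  have hαn' : |αn| ≤ 3/1000 := by
    rw [hαn]; linarith [abs_add_le (t*σ*ρ) p4]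
  have hνe' : |νe| ≤ 3/1000 := by
    rw [hνe]; linarith [abs_add_le (t*σ*ρ) p8]
  have hk : 0 ≤ t^2*ρ ∧ t^2*ρ ≤ 2/1000000 := by
    refine ⟨mul_nonneg ht0 (by linarith), ?_⟩
    calc t^2*ρ ≤ 1/1000000*2 := by gcongr
      _ = _ := by norm_num
  have hνn' : |νn| ≤ 3/1000 := by
    rw [hνn, show 1-σ^2 = t^2 by linarith]
    have : |-t^2*ρ| ≤ 2/1000 := by
      rw [abs_mul, abs_neg, abs_of_nonneg ht0, abs_of_nonneg (by linarith : 0 ≤ ρ)]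
      linarith [hk.2]
    linarith [abs_add_le (-t^2*ρ) p9]
  have hb3 := abs_le.1 e3
  have hb7 := abs_le.1 e7
  have hr : (1-t^2)*ρ = ρ - t^2*ρ := by ring
  have hαe' : |αe| ≤ 2001/1000 := by
    rw [hαe, neg_mul, hr, abs_le]; constructor <;> linarith
  have hγ' : |γ| ≤ 2001/1000 := by
    rw [hγ, hr, abs_le]; constructor <;> linarith
  have hαel : 665/1000 ≤ |αe| := by
    rw [hαe, neg_mul, hr]; refine le_trans ?_ (neg_le_abs _); linarith
  have hρ2 : 4/9 ≤ ρ^2 ∧ ρ^2 ≤ 4 := by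
    have hl := pow_le_pow_left₀ (by norm_num) h1 2
    have hu := pow_le_pow_left₀ (by linarith) h2 2
    constructor <;> linarith
  have hβe' : |βe| ≤ 13/1000 := by
    have : |(3*t-3*t^3)*ρ^2| ≤ 12/1000 := by
      have hpos : 0 ≤ (3-3*t^2)*ρ^2 := mul_nonneg (by linarith) (sq_nonneg ρ)
      rw [show (3*t-3*t^3)*ρ^2 = t * ((3-3*t^2)*ρ^2) by ring, abs_mul,
        abs_of_nonneg hpos]
      calc _ ≤ (1/1000:ℝ)*(3*4) := by gcongr <;> linarith
        _ = _ := by norm_num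
    rw [hβe]; linarith [abs_add_le ((3*t-3*t^3)*ρ^2) p5]
  have hβn' : 441/1000 ≤ |βn| := by
    have h : 442/1000 ≤ |(σ-3*t^2*σ)*ρ^2| := by
      rw [show (σ-3*t^2*σ)*ρ^2 = σ * ((1-3*t^2)*ρ^2) by ring, abs_mul,
        abs_of_nonneg (mul_nonneg (by linarith) (sq_nonneg ρ) : 0 ≤ (1-3*t^2)*ρ^2)]
      calc (442/1000:ℝ) ≤ (999/1000:ℝ)*((1-3/1000000)*(4/9)) := by norm_num
        _ ≤ _ := by gcongr <;> linarith
    have := abs_sub_abs_le_abs_sub ((σ-3*t^2*σ)*ρ^2) (-p6)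
    rw [abs_neg, sub_neg_eq_add] at this
    rw [hβn]; linarith
  have hg0 : g ≠ 0 := by rintro rfl; norm_num at hgl
  refine ⟨hg0, ?_⟩
  have m1 : 665/1000*(441/1000) ≤ |αe*βn| := by rw [abs_mul]; gcongr
  have m2 : |αn*βe| ≤ 3/1000*(13/1000) := by rw [abs_mul]; gcongr
  have m3 : |αe*νn| ≤ 2001/1000*(3/1000) := by rw [abs_mul]; gcongr
  have m4 : |αn*νe| ≤ 3/1000*(3/1000) := by rw [abs_mul]; gcongr
  have m5 : |γ/g| ≤ 21/10 := by
    rw [abs_div, div_le_iff₀ (by linarith)]; linarith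
  have m6 : |αe*νn-αn*νe| ≤ 7/1000 := by linarith [abs_sub (αe*νn) (αn*νe)]
  have m7 : |γ/g*(αe*νn-αn*νe)| ≤ 21/10*(7/1000) := by rw [abs_mul]; gcongr
  have m8 := abs_sub_abs_le_abs_sub (αe*βn) (αn*βe)
  have m9 := abs_sub_abs_le_abs_sub (αe*βn-αn*βe) (γ/g*(αe*νn-αn*νe))
  rw [abs_div, abs_abs, le_div_iff₀ (by linarith)]
  linarith

theorem norm_sub_le_of_mem_unit_square {a b : E2} (ha : ∀ i, a i ∈ Set.Icc (0:ℝ) 1)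
    (hb : ∀ i, b i ∈ Set.Icc (0:ℝ) 1) : ‖b - a‖ ≤ 3 / 2 := by
  have h := real_inner_self_eq_norm_sq (b - a)
  rw [inner_eq_coord] at h
  simp only [PiLp.sub_apply] at h
  obtain ⟨ha0, ha0'⟩ := ha 0
  obtain ⟨ha1, ha1'⟩ := ha 1
  obtain ⟨hb0, hb0'⟩ := hb 0
  obtain ⟨hb1, hb1'⟩ := hb 1
  nlinarith [norm_nonneg (b - a)]

section Perturbation

open scoped Topology ContDiff

variable {V : Type*} [NormedAddCommGroup V] [InnerProductSpace ℝ V] {G : V × V → ℝ}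

theorem contDiffAt_norm_sub_add (hG : ContDiff ℝ ∞ G) {p : V × V} (hp : p.1 ≠ p.2) :
    ContDiffAt ℝ ∞ (fun q => ‖q.2 - q.1‖ + G q) p :=
  (contDiffAt_norm_sub hp).add hG.contDiffAt

theorem dirDeriv_norm_sub_add_eventuallyEq (hG : ContDiff ℝ ∞ G) {p : V × V} (hp : p.1 ≠ p.2)
    (w : V × V) :
    dirDeriv w (fun q => ‖q.2 - q.1‖ + G q) =ᶠ[𝓝 p]
      fun q => dirDeriv w (fun q => ‖q.2 - q.1‖) q + dirDeriv w G q := by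
  filter_upwards [(isOpen_ne_fun continuous_fst continuous_snd).mem_nhds hp] with q hq
  exact dirDeriv_add ((contDiffAt_norm_sub hq).differentiableAt (by simp))
    (hG.differentiable (by simp) q) w

theorem dirDeriv_dirDeriv_norm_sub_add_eventuallyEq (hG : ContDiff ℝ ∞ G) {p : V × V}
    (hp : p.1 ≠ p.2) (v w : V × V) :
    dirDeriv v (dirDeriv w (fun q => ‖q.2 - q.1‖ + G q)) =ᶠ[𝓝 p]
      fun q => dirDeriv v (dirDeriv w (fun q => ‖q.2 - q.1‖)) q + dirDeriv v (dirDeriv w G) q := by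
  filter_upwards [(dirDeriv_norm_sub_add_eventuallyEq hG hp w).dirDeriv v,
    (isOpen_ne_fun continuous_fst continuous_snd).mem_nhds hp] with q hq hq'
  rw [hq]
  exact dirDeriv_add (((contDiffAt_norm_sub hq').dirDeriv w).differentiableAt (by simp))
    ((hG.dirDeriv w).differentiable (by simp) q) v

theorem dirDeriv_dirDeriv_dirDeriv_norm_sub_add (hG : ContDiff ℝ ∞ G) {p : V × V}
    (hp : p.1 ≠ p.2) (u v w : V × V) :
    dirDeriv u (dirDeriv v (dirDeriv w (fun q => ‖q.2 - q.1‖ + G q))) p =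
      dirDeriv u (dirDeriv v (dirDeriv w (fun q => ‖q.2 - q.1‖))) p +
        dirDeriv u (dirDeriv v (dirDeriv w G)) p := by
  rw [((dirDeriv_dirDeriv_norm_sub_add_eventuallyEq hG hp v w).dirDeriv u).eq_of_nhds]
  exact dirDeriv_add ((((contDiffAt_norm_sub hp).dirDeriv w).dirDeriv v).differentiableAt (by simp))
    (((hG.dirDeriv w).dirDeriv v).differentiable (by simp) p) u

end Perturbation

/-- Small smooth algebraic perturbations of the distance function satisfy
the cinematic curvature conditions uniformly for `a, b ∈ [0,1]²` with `1/2 ≤ |a-b|`. -/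
theorem statement_4 :
    ∃ ε₀ > (0:ℝ), ∃ c > (0:ℝ), ∀ P : E2 → E2 → ℝ,
      ContDiff ℝ (⊤ : ℕ∞) (fun p : E2 × E2 => P p.1 p.2) →
      (∃ Q : MvPolynomial (Fin 5) ℝ, Q ≠ 0 ∧ ∀ x y : E2,
        MvPolynomial.eval (![x 0, x 1, y 0, y 1, P x y]) Q = 0) →
      (∀ i : ℕ, i ≤ 3 → ∀ p : E2 × E2,
        ‖iteratedFDeriv ℝ i (fun q : E2 × E2 => P q.1 q.2) p‖ < ε₀) →
      ∀ a b : E2, (∀ i, a i ∈ Set.Icc (0:ℝ) 1) → (∀ i, b i ∈ Set.Icc (0:ℝ) 1) →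
        1/2 ≤ dist a b →
        c ≤ ‖gradY (fun x y => dist x y + P x y) a b‖ ∧
          ∀ e : E2, ‖e‖ = 1 →
            ⟪e, gradY (fun x y => dist x y + P x y) a b⟫ = 0 →
            c ≤ |cinDet (fun x y => dist x y + P x y) e a b| := by
  refine ⟨1 / 1000, by norm_num, 1 / 10, by norm_num, ?_⟩
  intro P hP _ hbound a b ha hb hab
  set G : E2 × E2 → ℝ := fun p => P p.1 p.2 with hGdef
  set F : E2 × E2 → ℝ := fun q => ‖q.2 - q.1‖ + G q with hFdef
  have hΦ : ∀ p : E2 × E2, (fun x y => dist x y + P x y) p.1 p.2 = F p := fun p => by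
    simp only [hFdef, hGdef, dist_comm p.1 p.2, dist_eq_norm]
  have hr : 1 / 2 ≤ ‖b - a‖ := by rwa [← dist_eq_norm, dist_comm]
  have hr' := norm_sub_le_of_mem_unit_square ha hb
  have hr0 : ‖b - a‖ ≠ 0 := by linarith
  have hne : ((a, b) : E2 × E2).1 ≠ ((a, b) : E2 × E2).2 := by
    rintro h
    exact hr0 (by simp [show a = b from h])
  have hF := contDiffAt_norm_sub_add hP hne
  have hsm : ∀ᶠ p in nhds (a, b), ContDiffAt ℝ (⊤ : ℕ∞) F p := by
    filter_upwards [(isOpen_ne_fun continuous_fst continuous_snd).mem_nhds hne] with p hp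
    exact contDiffAt_norm_sub_add hP hp
  have hgrad : ∀ v : E2, ⟪v, gradY (fun x y => dist x y + P x y) a b⟫ =
      dirDeriv (0, v) F (a, b) := fun v =>
    inner_gradY_of_eventuallyEq (Filter.Eventually.of_forall hΦ) (hF.differentiableAt (by simp)) v
  have hb1 : ∀ w : E2 × E2, ‖w‖ ≤ 1 → |dirDeriv w G (a, b)| ≤ 1 / 1000 := fun w hw =>
    (abs_dirDeriv_le hP hw _).trans (hbound 1 (by norm_num) _).le
  have hb2 : ∀ v w : E2 × E2, ‖v‖ ≤ 1 → ‖w‖ ≤ 1 →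
      |dirDeriv v (dirDeriv w G) (a, b)| ≤ 1 / 1000 := fun v w hv hw =>
    (abs_dirDeriv_dirDeriv_le hP hv hw _).trans (hbound 2 (by norm_num) _).le
  have hb3 : ∀ u v w : E2 × E2, ‖u‖ ≤ 1 → ‖v‖ ≤ 1 → ‖w‖ ≤ 1 →
      |dirDeriv u (dirDeriv v (dirDeriv w G)) (a, b)| ≤ 1 / 1000 := fun u v w hu hv hw =>
    (abs_dirDeriv_dirDeriv_dirDeriv_le hP hu hv hw _).trans (hbound 3 le_rfl _).le
  have hF1 : ∀ w : E2 × E2, dirDeriv w F (a, b) =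
      ⟪b - a, w.2 - w.1⟫ / ‖b - a‖ + dirDeriv w G (a, b) := fun w => by
    rw [(dirDeriv_norm_sub_add_eventuallyEq hP hne w).eq_of_nhds, dirDeriv_norm_sub hne]
  have hF2 : ∀ v w : E2 × E2, dirDeriv v (dirDeriv w F) (a, b) = _ + _ := fun v w => by
    rw [(dirDeriv_dirDeriv_norm_sub_add_eventuallyEq hP hne v w).eq_of_nhds,
      dirDeriv_dirDeriv_norm_sub hne]
  have hF3 : ∀ u v w : E2 × E2, dirDeriv u (dirDeriv v (dirDeriv w F)) (a, b) = _ + _ :=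
    fun u v w => by
      rw [dirDeriv_dirDeriv_dirDeriv_norm_sub_add hP hne,
        dirDeriv_dirDeriv_dirDeriv_norm_sub hne]
  constructor
  · set u : E2 := ‖b - a‖⁻¹ • (b - a) with hu
    have hu1 : ‖u‖ = 1 := by
      rw [hu, norm_smul, norm_inv, norm_norm, inv_mul_cancel₀ hr0]
    have h1 : dirDeriv (0, u) F (a, b) = 1 + dirDeriv (0, u) G (a, b) := by
      rw [hF1]
      simp only [sub_zero, hu, inner_smul_right, real_inner_self_eq_norm_sq]
      field_simp
    have h2 := abs_le.1 (hb1 (0, u) (by simp [Prod.norm_def, hu1]))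
    have h3 := real_inner_le_norm u (gradY (fun x y => dist x y + P x y) a b)
    rw [hgrad, h1, hu1, one_mul] at h3
    linarith [h2.1]
  · intro e he h0
    rw [hgrad] at h0
    have hn : ‖rotate e‖ = 1 := (norm_rotate e).trans he
    have n1 : ‖((0, e) : E2 × E2)‖ ≤ 1 := by simp [Prod.norm_def, he]
    have n2 : ‖((e, 0) : E2 × E2)‖ ≤ 1 := by simp [Prod.norm_def, he]
    have n3 : ‖((0, rotate e) : E2 × E2)‖ ≤ 1 := by simp [Prod.norm_def, hn]
    have n4 : ‖((rotate e, 0) : E2 × E2)‖ ≤ 1 := by simp [Prod.norm_def, hn]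
    have hee : ⟪e, e⟫ = 1 := by rw [real_inner_self_eq_norm_sq, he]; norm_num
    have hrr : ⟪rotate e, rotate e⟫ = 1 := by rw [real_inner_self_eq_norm_sq, hn]; norm_num
    have her := inner_rotate_self e
    have hre : ⟪rotate e, e⟫ = 0 := by rw [real_inner_comm, her]
    have hpyth := norm_sq_eq_inner_sq_add he (b - a)
    rw [real_inner_comm, real_inner_comm (b - a) (rotate e)] at hpyth
    obtain ⟨hg0, hdet⟩ := le_abs_perturbed_det (ρ := ‖b - a‖⁻¹)
      (t := ⟪b - a, e⟫ / ‖b - a‖) (σ := ⟪b - a, rotate e⟫ / ‖b - a‖)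
      (by rw [le_inv_comm₀ (by norm_num) (by linarith)]; linarith)
      (by rw [inv_le_comm₀ (by linarith) (by norm_num)]; linarith)
      (by field_simp; linarith)
      (hb1 (0, e) n1) (hb1 (0, rotate e) n3)
      (hb2 (e, 0) (0, e) n2 n1) (hb2 (rotate e, 0) (0, e) n4 n1)
      (hb3 (e, 0) (0, e) (0, e) n2 n1 n1) (hb3 (rotate e, 0) (0, e) (0, e) n4 n1 n1)
      (hb2 (0, e) (0, e) n1 n1) (hb2 (e, 0) (0, rotate e) n2 n3)
      (hb2 (rotate e, 0) (0, rotate e) n4 n3)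
      (g := dirDeriv (0, rotate e) F (a, b))
      (αe := dirDeriv (e, 0) (dirDeriv (0, e) F) (a, b))
      (αn := dirDeriv (rotate e, 0) (dirDeriv (0, e) F) (a, b))
      (βe := dirDeriv (e, 0) (dirDeriv (0, e) (dirDeriv (0, e) F)) (a, b))
      (βn := dirDeriv (rotate e, 0) (dirDeriv (0, e) (dirDeriv (0, e) F)) (a, b))
      (γ := dirDeriv (0, e) (dirDeriv (0, e) F) (a, b))
      (νe := dirDeriv (e, 0) (dirDeriv (0, rotate e) F) (a, b))
      (νn := dirDeriv (rotate e, 0) (dirDeriv (0, rotate e) F) (a, b))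
      (by rw [← h0, hF1]; simp)
      (by rw [hF1]; simp)
      (by rw [hF2]; simp only [sub_zero, zero_sub, inner_neg_left, inner_neg_right, hee]
          field_simp; ring)
      (by rw [hF2]; simp only [sub_zero, zero_sub, inner_neg_left, inner_neg_right, hre]
          field_simp; ring)
      (by rw [hF3]; simp only [sub_zero, zero_sub, inner_neg_left, inner_neg_right, hee]
          field_simp; ring)
      (by rw [hF3]; simp only [sub_zero, zero_sub, inner_neg_left, inner_neg_right, hee, hre]
          field_simp; ring)
      (by rw [hF2]; simp only [sub_zero, hee]
          field_simp)
      (by rw [hF2]; simp only [sub_zero, zero_sub, inner_neg_left, inner_neg_right, her]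
          field_simp; ring)
      (by rw [hF2]; simp only [sub_zero, zero_sub, inner_neg_left, inner_neg_right, hrr]
          field_simp; ring)
    rw [cinDet_eq hΦ hF hsm he h0 hg0]
    exact hdet

end
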